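/- arXiv:2407.18878 — 2 statements merged into one kernel-verified Lean document; each statement's English description precedes it below -/
import Mathlib

section
/- For every λ ∈ (0,1] and every real c with c ≥ λ + √(1/λ² − 1), one has c·u − √(u(1−u)) + λ(1−u) ≥ λ/2 for all u ∈ [0,1]. -/
/-- For every `λ ∈ (0,1]` and every real `c` with `c ≥ λ + √(1/λ² − 1)`, one has
`c·u − √(u(1−u)) + λ(1−u) ≥ λ/2` for all `u ∈ [0,1]`. -/
theorem scalar_min_inequality (lam c : ℝ) (hlam : lam ∈ Set.Ioc (0 : ℝ) 1)
    (hc : c ≥ lam + Real.sqrt (1 / lam ^ 2 - 1)) :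
    ∀ u ∈ Set.Icc (0 : ℝ) 1,
      c * u - Real.sqrt (u * (1 - u)) + lam * (1 - u) ≥ lam / 2 := by
  rintro u ⟨hu0, -⟩
  obtain ⟨hpos, hle⟩ := hlam
  have hs0 := Real.sqrt_nonneg (1 / lam ^ 2 - 1)
  have hs : Real.sqrt (1 / lam ^ 2 - 1) ^ 2 = 1 / lam ^ 2 - 1 := by
    apply Real.sq_sqrt
    rw [sub_nonneg, le_div_iff₀ (by positivity)]
    nlinarith
  set s := Real.sqrt (1 / lam ^ 2 - 1)
  have hsqrt : Real.sqrt (u * (1 - u)) ≤ s * u + lam / 2 := by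
    apply Real.sqrt_le_iff.mpr ⟨by positivity, ?_⟩
    have key : (s * u + lam / 2) ^ 2 - u * (1 - u) =
        (u / lam - lam / 2) ^ 2 + s * lam * u := by
      have expand : (s * u + lam / 2) ^ 2 = s ^ 2 * u ^ 2 + s * lam * u + lam ^ 2 / 4 := by ring
      rw [expand, hs]
      field_simp
      ring
    have : 0 ≤ (u / lam - lam / 2) ^ 2 + s * lam * u := by positivity
    linarith
  have hcu : (lam + s) * u ≤ c * u := mul_le_mul_of_nonneg_right hc hu0
  linarith
end

section
/- Let (Ω, 𝓕, ℙ) be a probability space, d ≥ 1, T_max ≥ 2 an integer, and J = ⌊log₂ T_max⌋. Let Q : Ω → ℕ be a random variable with ℙ(Q = j) = 2^(−j) for every integer j ≥ 1, and let (g^j)_{j ≥ 0} be integrable ℝ^d-valued random vectors such that Q is independent of the σ-algebra generated by (g^j)_{j ≥ 0}. Define the MLMC estimator G := g^0 + 2^Q (g^Q − g^{Q−1}) on the event {2^Q ≤ T_max} and G := g^0 otherwise. Then E[G] = E[g^J]. -/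
open MeasureTheory ProbabilityTheory

/-- Lemma C.1(a): the MLMC estimator `G = g⁰ + 2^Q (g^Q − g^{Q−1}) 1{2^Q ≤ T_max}` with
`Q ~ Geom(1/2)` independent of the estimates satisfies `E[G] = E[g^⌊log₂ T_max⌋]`. -/
theorem mlmc_expectation {Ω : Type*} [MeasurableSpace Ω]
    (μ : Measure Ω) [IsProbabilityMeasure μ]
    (d : ℕ) (hd : 1 ≤ d) (Tmax : ℕ) (hT : 2 ≤ Tmax)
    (Q : Ω → ℕ) (hQmeas : Measurable Q)
    (hQ : ∀ j : ℕ, 1 ≤ j → μ {ω | Q ω = j} = (1 / 2 : ENNReal) ^ j)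
    (g : ℕ → Ω → EuclideanSpace ℝ (Fin d))
    (hgmeas : ∀ j, Measurable (g j))
    (hgint : ∀ j, Integrable (g j) μ)
    (hindep : Indep (MeasurableSpace.comap Q inferInstance)
      (⨆ j : ℕ, MeasurableSpace.comap (g j) inferInstance) μ)
    (G : Ω → EuclideanSpace ℝ (Fin d))
    (hG : G = fun ω => g 0 ω +
      (if 2 ^ Q ω ≤ Tmax then ((2 : ℝ) ^ Q ω) • (g (Q ω) ω - g (Q ω - 1) ω) else 0)) :
    ∫ ω, G ω ∂μ = ∫ ω, g (Nat.log 2 Tmax) ω ∂μ := by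
  have hg' : ∀ j, Measurable[⨆ j : ℕ, MeasurableSpace.comap (g j) inferInstance] (g j) :=
    fun j => (comap_measurable (g j)).mono
      (le_iSup (fun j => MeasurableSpace.comap (g j) inferInstance) j) le_rfl
  have hlevel : ∀ j, MeasurableSet {ω | Q ω = j} := fun j => hQmeas (measurableSet_singleton j)
  have hdecomp : ∀ ω, G ω = g 0 ω + ∑ j ∈ Finset.range (Nat.log 2 Tmax),
      {ω | Q ω = j + 1}.indicator
        (fun ω => (2 : ℝ) ^ (j + 1) • (g (j + 1) ω - g j ω)) ω := by
    intro ω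
    rw [hG]
    simp only [Set.indicator_apply, Set.mem_ofPred_eq]
    congr 1
    have hlog : 2 ^ Q ω ≤ Tmax ↔ Q ω ≤ Nat.log 2 Tmax :=
      (Nat.le_log_iff_pow_le one_lt_two (by omega)).symm
    rw [if_congr hlog rfl rfl]
    obtain ⟨q, hq⟩ : ∃ q, Q ω = q := ⟨_, rfl⟩
    cases q with
    | zero => simp [hq]
    | succ q => simp [hq, Finset.sum_ite_eq]
  have hint : ∀ j, Integrable (fun ω => (2 : ℝ) ^ (j + 1) • (g (j + 1) ω - g j ω)) μ :=
    fun j => ((hgint (j + 1)).sub (hgint j)).smul ((2 : ℝ) ^ (j + 1))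
  have hterm : ∀ j, ∫ ω, {ω | Q ω = j + 1}.indicator
      (fun ω => (2 : ℝ) ^ (j + 1) • (g (j + 1) ω - g j ω)) ω ∂μ
        = ∫ ω, g (j + 1) ω ∂μ - ∫ ω, g j ω ∂μ := by
    intro j
    have hreal : μ.real {ω | Q ω = j + 1} = (1 / 2 : ℝ) ^ (j + 1) := by
      simp [Measure.real, hQ (j + 1) (by omega)]
    have hX : Measurable[⨆ j : ℕ, MeasurableSpace.comap (g j) inferInstance]
        (fun ω => (2 : ℝ) ^ (j + 1) • (g (j + 1) ω - g j ω)) :=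
      ((hg' (j + 1)).sub (hg' j)).const_smul ((2 : ℝ) ^ (j + 1))
    have hset : ∫ ω in {ω | Q ω = j + 1}, (2 : ℝ) ^ (j + 1) • (g (j + 1) ω - g j ω) ∂μ
        = μ.real {ω | Q ω = j + 1} • ∫ ω, (2 : ℝ) ^ (j + 1) • (g (j + 1) ω - g j ω) ∂μ :=
      Indep.setIntegral_eq_smul (f := id) hQmeas.comap_le
        (indep_of_indep_of_le_right hindep hX.comap_le) (hint j).aemeasurable
        ⟨{j + 1}, measurableSet_singleton _, rfl⟩ aestronglyMeasurable_id
    rw [integral_indicator (hlevel _), hset, integral_smul, integral_sub (hgint _) (hgint _), hreal, smul_smul, ← mul_pow]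
    norm_num
  rw [integral_congr_ae (.of_forall hdecomp), integral_add (hgint 0)
      (integrable_finsetSum _ fun j _ => (hint j).indicator (hlevel _)),
    integral_finsetSum _ fun j _ => (hint j).indicator (hlevel _)]
  simp only [hterm]
  rw [Finset.sum_range_sub (fun j => ∫ ω, g j ω ∂μ), add_sub_cancel]
end
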